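/- Let w ≡ 0 (mod 6), w ≥ 12, and let f_w be the normalized extremal quasimodular form of weight w and depth 1 (which satisfies ∂_{w−1}^2 f_w − ((w^2−1)/144) E_4 f_w = 0). Then (1/Δ)(E_4 ∂_{w−1} f_w + ((w−1)/12) E_6 f_w) = (w/6) f_{w−6}, i.e., the operator K^down_w f = Δ^{−1}(E_4 ∂_{w−1} f + ((w−1)/12) E_6 f) maps f_w to (w/6) times the normalized extremal quasimodular form of weight w−6 and depth 1. Moreover, K^down_{w+6}(E_4 ∂_{w−1} f_w − ((w+1)/12) E_6 f_w) = 12(w+1)(w+5) f_w. -/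

import Mathlib

open Complex UpperHalfPlane Finset
open scoped Manifold MatrixGroups Real

noncomputable section

/-- The nome `q = e^{2πiz}`. -/
def qexp (z : ℍ) : ℂ := Complex.exp (2 * Real.pi * Complex.I * z)

/-- The normalized Eisenstein series `E_k` (for even `k ≥ 2`), defined via its
`q`-expansion `E_k = 1 - (2k/B_k) ∑_{n ≥ 1} σ_{k-1}(n) q^n`. -/
def Eis (k : ℕ) (z : ℍ) : ℂ :=
  1 - (2 * k / ((bernoulli k : ℚ) : ℂ)) *
    ∑' n : ℕ, (ArithmeticFunction.sigma (k - 1) (n + 1) : ℂ) * qexp z ^ (n + 1)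

/-- The modular discriminant `Δ = (E_4³ − E_6²)/1728`. -/
def Disc (z : ℍ) : ℂ := (Eis 4 z ^ 3 - Eis 6 z ^ 2) / 1728

/-- The space of holomorphic modular forms of weight `w` for the full modular group,
as a set of functions on `ℍ`. -/
def Mset (w : ℤ) : Set (ℍ → ℂ) :=
  {f | ∃ F : ModularForm (⊤ : Subgroup SL(2, ℤ)) w, ⇑F = f}

/-- The set of quasimodular forms of weight `w` and depth `≤ r`:
functions of the form `∑_{ℓ=0}^r E_2^ℓ h_ℓ` with `h_ℓ ∈ M_{w-2ℓ}`. -/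
def QMset (w : ℤ) (r : ℕ) : Set (ℍ → ℂ) :=
  {f | ∃ h : ℕ → ℍ → ℂ, (∀ ℓ ≤ r, h ℓ ∈ Mset (w - 2 * ℓ)) ∧
        ∀ z, f z = ∑ ℓ ∈ Finset.range (r + 1), Eis 2 z ^ ℓ * h ℓ z}

/-- `QM_w^r` as a `ℂ`-subspace of the functions on `ℍ`. -/
def QM (w : ℤ) (r : ℕ) : Submodule ℂ (ℍ → ℂ) := Submodule.span ℂ (QMset w r)

/-- `dim QM_w^r`. -/
def dimQM (w : ℤ) (r : ℕ) : ℕ := Module.finrank ℂ (QM w r)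

/-- The complex derivative of a function on `ℍ` (via an extension to `ℂ`; since `ℍ` is
open in `ℂ` this agrees with the complex derivative for holomorphic `f`). -/
def hderiv (f : ℍ → ℂ) (z : ℍ) : ℂ :=
  deriv (fun w : ℂ => if h : 0 < w.im then f ⟨w, h⟩ else 0) z

/-- The normalized derivative `f' = (2πi)⁻¹ df/dz = q df/dq`. -/
def qderiv (f : ℍ → ℂ) (z : ℍ) : ℂ := (2 * Real.pi * Complex.I)⁻¹ * hderiv f z

/-- The Serre derivative `∂_w f = f' - (w/12) E_2 f`. -/
def serre (w : ℤ) (f : ℍ → ℂ) (z : ℍ) : ℂ :=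
  qderiv f z - ((w : ℂ) / 12) * Eis 2 z * f z

/-- Iterated Serre derivatives: `∂_w^0 f = f`, `∂_w^{k+1} f = ∂_{w+2k}(∂_w^k f)`. -/
def serreIter (w : ℤ) : ℕ → (ℍ → ℂ) → (ℍ → ℂ)
  | 0, f => f
  | (k + 1), f => serre (w + 2 * k) (serreIter w k f)

/-- `z ↦ -1/z` as a map `ℍ → ℍ`. -/
def Sact (z : ℍ) : ℍ :=
  ⟨-(z : ℂ)⁻¹, by
    have h0 : (z : ℂ) ≠ 0 := z.ne_zero
    have : (-(z : ℂ)⁻¹).im = (z : ℂ).im / Complex.normSq (z : ℂ) := by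
      rw [Complex.neg_im, Complex.inv_im]; ring
    rw [this]
    exact div_pos z.im_pos (Complex.normSq_pos.mpr h0)⟩

/-- `z ↦ z + 1` as a map `ℍ → ℍ`. -/
def Tact (z : ℍ) : ℍ := ⟨(z : ℂ) + 1, by simpa using z.im_pos⟩

/-- `g` has a `q`-expansion with vanishing order exactly `ν` at `i∞`:
`g = q^ν ∑_{n≥0} a(n) qⁿ` with `a(0) ≠ 0`. -/
def HasQExpansionAt (g : ℍ → ℂ) (ν : ℕ) : Prop :=
  ∃ a : ℕ → ℂ, a 0 ≠ 0 ∧ ∀ z : ℍ, HasSum (fun n : ℕ => a n * qexp z ^ (ν + n)) (g z)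

/-- The quasimodular forms `g_ℓ` attached to `f = ∑_{ℓ=0}^r E_2^ℓ h_ℓ`, defined by
`C(r,ℓ) g_ℓ = (6/(πi))^ℓ ∑_{m=0}^{r-ℓ} C(ℓ+m,m) E_2^m h_{ℓ+m}`. -/
def gOf (r : ℕ) (h : ℕ → ℍ → ℂ) (ℓ : ℕ) (z : ℍ) : ℂ :=
  ((r.choose ℓ : ℂ))⁻¹ * (6 / ((Real.pi : ℂ) * Complex.I)) ^ ℓ *
    ∑ m ∈ Finset.range (r - ℓ + 1), (((ℓ + m).choose m : ℕ) : ℂ) * Eis 2 z ^ m * h (ℓ + m) z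

/-- `f` is a balanced quasimodular form of weight `w` and depth `r`. -/
def IsBalancedQM (w : ℤ) (r : ℕ) (f : ℍ → ℂ) : Prop :=
  ∃ h : ℕ → ℍ → ℂ, ∃ lam : ℕ → ℕ,
    (∀ ℓ ≤ r, h ℓ ∈ Mset (w - 2 * ℓ)) ∧ h r ≠ 0 ∧
    (∀ z, f z = ∑ ℓ ∈ Finset.range (r + 1), Eis 2 z ^ ℓ * h ℓ z) ∧
    (∀ ℓ ≤ r, HasQExpansionAt (gOf r h ℓ) (lam ℓ)) ∧
    (∀ i j, i ≤ j → j ≤ r → lam j ≤ lam i) ∧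
    (∀ ℓ ≤ r, lam ℓ < dimQM (w - 2 * ℓ) (r - ℓ)) ∧
    (∑ ℓ ∈ Finset.range (r + 1), lam ℓ) = dimQM w r - 1

/-- `f` is the normalized extremal quasimodular form of weight `w` and depth `r`:
`f ∈ QM_w^r` with `q`-expansion `q^{dim QM_w^r - 1}(1 + O(q))`. -/
def IsNormalizedExtremalQM (w : ℤ) (r : ℕ) (f : ℍ → ℂ) : Prop :=
  f ∈ QM w r ∧ ∃ a : ℕ → ℂ, a 0 = 1 ∧
    ∀ z : ℍ, HasSum (fun n : ℕ => a n * qexp z ^ (dimQM w r - 1 + n)) (f z)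

/-- `f 0, …, f (n-1)` is a fundamental system of solutions of the linear differential
equation `K g = 0`: holomorphic linearly independent solutions spanning all
holomorphic solutions. -/
def IsFundamentalSystem {n : ℕ} (K : (ℍ → ℂ) → (ℍ → ℂ)) (f : Fin n → ℍ → ℂ) : Prop :=
  (∀ i, MDifferentiable 𝓘(ℂ) 𝓘(ℂ) (f i)) ∧ (∀ i, K (f i) = 0) ∧
    LinearIndependent ℂ f ∧
    ∀ g : ℍ → ℂ, MDifferentiable 𝓘(ℂ) 𝓘(ℂ) g → K g = 0 → g ∈ Submodule.span ℂ (Set.range f)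


/-- `F = (f_0, …, f_r)ᵀ` is a quasimodular vector of weight `w` and dimension `r+1`:
all components are holomorphic and there is a quasimodular form `f = ∑_{ℓ=0}^s E_2^ℓ h_ℓ`
of weight `w` and depth `s ≤ r` such that
`f_k(z) = ∑_{ℓ=0}^{min(k,s)} C(k,ℓ) z^{k-ℓ} g_ℓ(z)` for the attached forms `g_ℓ`. -/
def IsQuasimodularVector (w : ℤ) (r : ℕ) (F : Fin (r + 1) → ℍ → ℂ) : Prop :=
  (∀ k, MDifferentiable 𝓘(ℂ) 𝓘(ℂ) (F k)) ∧
  ∃ s : ℕ, s ≤ r ∧ ∃ h : ℕ → ℍ → ℂ,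
    (∀ ℓ ≤ s, h ℓ ∈ Mset (w - 2 * ℓ)) ∧ (s = 0 ∨ h s ≠ 0) ∧
    ∀ (k : Fin (r + 1)) (z : ℍ),
      F k z = ∑ ℓ ∈ Finset.range (min (k : ℕ) s + 1),
        (((k : ℕ).choose ℓ : ℕ) : ℂ) * (z : ℂ) ^ ((k : ℕ) - ℓ) * gOf s h ℓ z

/-- The modular Wronskian `W(z) = det(F, ∂_{w-r}F, …, ∂_{w-r}^r F)`. -/
def modularWronskian (w : ℤ) (r : ℕ) (F : Fin (r + 1) → ℍ → ℂ) (z : ℍ) : ℂ :=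
  Matrix.det (Matrix.of fun (k j : Fin (r + 1)) => serreIter (w - r) (j : ℕ) (F k) z)

end

section

open scoped ModularForm

/-- `f` is the sum of the power series `p` in the nome. -/
def HasQSeries (f : ℍ → ℂ) (p : PowerSeries ℂ) : Prop :=
  ∀ z : ℍ, HasSum (fun n : ℕ => p.coeff n * qexp z ^ n) (f z)

lemma norm_qexp_lt_one (z : ℍ) : ‖qexp z‖ < 1 :=
  UpperHalfPlane.norm_exp_two_pi_I_lt_one z

lemma exists_qexp_eq {x : ℂ} (hx0 : x ≠ 0) (hx : ‖x‖ < 1) : ∃ z : ℍ, qexp z = x := by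
  refine ⟨⟨Function.Periodic.invQParam 1 x,
    Function.Periodic.im_invQParam_pos_of_norm_lt_one one_pos hx hx0⟩, ?_⟩
  have h := Function.Periodic.qParam_right_inv (h := 1) one_ne_zero hx0
  simpa [Function.Periodic.qParam, qexp] using h

namespace HasQSeries

variable {f g : ℍ → ℂ} {p r : PowerSeries ℂ}

lemma hasFPowerSeriesOnBall (hf : HasQSeries f p) :
    HasFPowerSeriesOnBall (fun x : ℂ => ∑' n : ℕ, p.coeff n * x ^ n)
      (.ofScalars ℂ fun n => p.coeff n) 0 1 := by
  have hs {x : ℂ} (hx : ‖x‖ < 1) : Summable fun n : ℕ => p.coeff n * x ^ n := by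
    by_cases hx0 : x = 0
    · subst hx0
      exact summable_of_ne_finset_zero (s := {0}) fun n hn => by
        simp [zero_pow (by simpa using hn : n ≠ 0)]
    · obtain ⟨z, rfl⟩ := exists_qexp_eq hx0 hx
      exact (hf z).summable
  refine ⟨?_, one_pos, fun {y} hy => ?_⟩
  · refine ENNReal.le_of_forall_nnreal_lt fun ρ hρ => ?_
    apply FormalMultilinearSeries.le_radius_of_tendsto (l := 0)
    have hρ1 : ‖((ρ : ℝ) : ℂ)‖ < 1 := by simpa using hρ
    have := (hs hρ1).tendsto_atTop_zero.norm
    simpa using this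
  · have hy' : ‖y‖ < 1 := by simpa [← ofReal_norm] using hy
    simpa [FormalMultilinearSeries.ofScalars, mul_comm] using (hs hy').hasSum

lemma eq_tsum (hf : HasQSeries f p) (z : ℍ) : f z = ∑' n : ℕ, p.coeff n * qexp z ^ n :=
  (hf z).tsum_eq.symm

lemma summable_norm (hf : HasQSeries f p) (z : ℍ) :
    Summable fun n : ℕ => ‖p.coeff n * qexp z ^ n‖ := (hf z).summable.norm

lemma unique (hf : HasQSeries f p) (hr : HasQSeries f r) : p = r := by
  have h : (fun x : ℂ => ∑' n : ℕ, p.coeff n * x ^ n) =ᶠ[nhdsWithin 0 {0}ᶜ]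
      fun x : ℂ => ∑' n : ℕ, r.coeff n * x ^ n := by
    filter_upwards [self_mem_nhdsWithin,
      mem_nhdsWithin_of_mem_nhds (Metric.ball_mem_nhds (0 : ℂ) one_pos)] with x hx0 hx
    obtain ⟨z, rfl⟩ := exists_qexp_eq hx0 (by simpa using hx)
    rw [← hf.eq_tsum, hr.eq_tsum]
  have hp := hf.hasFPowerSeriesOnBall.hasFPowerSeriesAt
  have hq := hr.hasFPowerSeriesOnBall.hasFPowerSeriesAt
  have h' := (hp.continuousAt.eventuallyEq_nhds_iff_eventuallyEq_nhdsNE hq.continuousAt).mp h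
  have := hp.eq_formalMultilinearSeries_of_eventually hq h'
  ext n
  simpa using congr_arg (FormalMultilinearSeries.coeff · n) this

lemma eq_zero (hf : HasQSeries f 0) (z : ℍ) : f z = 0 := by
  simpa using hf.eq_tsum z

lemma const (c : ℂ) : HasQSeries (fun _ => c) (PowerSeries.C c) := fun z => by
  convert! hasSum_single (f := fun n : ℕ => (PowerSeries.C c).coeff n * qexp z ^ n) 0 ?_ using 1
  · simp
  · intro n hn; simp [PowerSeries.coeff_C, hn]

lemma add (hf : HasQSeries f p) (hg : HasQSeries g r) :
    HasQSeries (fun z => f z + g z) (p + r) := fun z => by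
  simpa [add_mul] using (hf z).add (hg z)

lemma sub (hf : HasQSeries f p) (hg : HasQSeries g r) :
    HasQSeries (fun z => f z - g z) (p - r) := fun z => by
  simpa [sub_mul] using (hf z).sub (hg z)

lemma mul (hf : HasQSeries f p) (hg : HasQSeries g r) :
    HasQSeries (fun z => f z * g z) (p * r) := fun z => by
  have h := (summable_norm_sum_mul_antidiagonal_of_summable_norm (hf.summable_norm z)
    (hg.summable_norm z)).of_norm.hasSum
  rw [← tsum_mul_tsum_eq_tsum_sum_antidiagonal_of_summable_norm (hf.summable_norm z)
    (hg.summable_norm z), ← hf.eq_tsum, ← hg.eq_tsum] at h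
  refine h.congr_fun fun n => ?_
  rw [PowerSeries.coeff_mul, Finset.sum_mul]
  refine Finset.sum_congr rfl fun ij hij => ?_
  rw [← HasAntidiagonal.mem_antidiagonal.mp hij, pow_add]
  ring

lemma const_mul (c : ℂ) (hf : HasQSeries f p) :
    HasQSeries (fun z => c * f z) (PowerSeries.C c * p) := (const c).mul hf

lemma differentiableAt (hf : HasQSeries f p) {x : ℂ} (hx : ‖x‖ < 1) :
    DifferentiableAt ℂ (fun x : ℂ => ∑' n : ℕ, p.coeff n * x ^ n) x :=
  (hf.hasFPowerSeriesOnBall.analyticAt_of_mem (by simpa [← ofReal_norm] using hx)).differentiableAt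

lemma hasDerivAt (hf : HasQSeries f p) (z : ℍ) :
    HasDerivAt (f ∘ ofComplex) (2 * Real.pi * Complex.I *
      (qexp z * deriv (fun x : ℂ => ∑' n : ℕ, p.coeff n * x ^ n) (qexp z))) z := by
  have h1 : HasDerivAt (fun w : ℂ => Complex.exp (2 * Real.pi * Complex.I * w))
      (qexp z * (2 * Real.pi * Complex.I * 1)) z :=
    ((hasDerivAt_id (z : ℂ)).const_mul _).cexp
  have h2 := ((hf.differentiableAt (norm_qexp_lt_one z)).hasDerivAt.comp (z : ℂ) h1)
  refine (h2.congr_of_eventuallyEq ?_).congr_deriv (by ring)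
  filter_upwards [isOpen_upperHalfPlaneSet.mem_nhds z.2] with w hw
  have := hf.eq_tsum ⟨w, hw⟩
  simpa [qexp, ofComplex_apply_of_im_pos hw] using this

lemma mdifferentiable (hf : HasQSeries f p) : MDifferentiable 𝓘(ℂ) 𝓘(ℂ) f := fun z =>
  UpperHalfPlane.mdifferentiableAt_iff.mpr (hf.hasDerivAt z).differentiableAt

end HasQSeries

lemma qderiv_eq_normalizedDerivOfComplex (f : ℍ → ℂ) :
    qderiv f = Derivative.normalizedDerivOfComplex f := by
  ext z
  unfold qderiv hderiv Derivative.normalizedDerivOfComplex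
  congr 1
  apply Filter.EventuallyEq.deriv_eq
  filter_upwards [isOpen_upperHalfPlaneSet.mem_nhds z.2] with w hw
  have him : 0 < w.im := hw
  simp [him, ofComplex_apply_of_im_pos him]

/-- The Euler operator `X d/dX` on power series. -/
noncomputable def eulerOp (p : PowerSeries ℂ) : PowerSeries ℂ :=
  PowerSeries.X * PowerSeries.derivative ℂ p

lemma coeff_eulerOp (p : PowerSeries ℂ) (n : ℕ) : (eulerOp p).coeff n = n * p.coeff n := by
  cases n with
  | zero => simp [eulerOp]
  | succ n =>
    rw [eulerOp, PowerSeries.coeff_succ_X_mul, PowerSeries.coeff_derivative]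
    push_cast
    ring

lemma HasQSeries.qderiv {f : ℍ → ℂ} {p : PowerSeries ℂ} (hf : HasQSeries f p) :
    HasQSeries (qderiv f) (eulerOp p) := fun z => by
  have hz : qexp z ∈ Metric.eball (0 : ℂ) 1 := by
    simpa [← ofReal_norm] using norm_qexp_lt_one z
  have h := hf.hasFPowerSeriesOnBall.fderiv.hasSum hz
  have h2 := h.mapL (ContinuousLinearMap.apply ℂ ℂ (qexp z))
  rw [qderiv_eq_normalizedDerivOfComplex, Derivative.normalizedDerivOfComplex,
    (hf.hasDerivAt z).deriv, ← hasSum_nat_add_iff' 1]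
  have hpi : (2 * Real.pi * Complex.I : ℂ) ≠ 0 := Complex.two_pi_I_ne_zero
  convert! h2 using 1
  · ext n
    rw [coeff_eulerOp, ContinuousLinearMap.apply_apply,
      FormalMultilinearSeries.derivSeries_apply_diag]
    simp [mul_assoc, mul_comm (qexp z ^ (n + 1))]
  · rw [inv_mul_cancel_left₀ hpi]
    simp [coeff_eulerOp]

lemma coe_top_eq_SL : ((⊤ : Subgroup SL(2, ℤ)) : Subgroup (GL (Fin 2) ℝ)) = 𝒮ℒ :=
  (MonoidHom.range_eq_map _).symm

lemma mem_Mset_iff_exists {k : ℤ} {f : ℍ → ℂ} : f ∈ Mset k ↔ ∃ F : ModularForm 𝒮ℒ k, ⇑F = f := by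
  rw [Mset, Set.mem_ofPred_eq, coe_top_eq_SL]

lemma ModularForm.hasQSeries {k : ℤ} (F : ModularForm 𝒮ℒ k) :
    HasQSeries F (qExpansion 1 F) := fun z => by
  have : Fact (IsCusp OnePoint.infty 𝒮ℒ) :=
    ⟨(𝒮ℒ).isCusp_of_mem_strictPeriods one_pos one_mem_strictPeriods_SL⟩
  have h := ModularForm.hasSum_qExpansion F one_pos one_mem_strictPeriods_SL z
  simpa [Function.Periodic.qParam, qexp] using h

lemma HasQSeries.isBoundedAtImInfty {f : ℍ → ℂ} {p : PowerSeries ℂ} (hf : HasQSeries f p) :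
    IsBoundedAtImInfty f := by
  refine isBoundedAtImInfty_of_hasSum_qExpansion (c := fun n => p.coeff n) one_pos fun z => ?_
  simpa [Function.Periodic.qParam, qexp] using hf z

lemma mem_Mset_iff {k : ℤ} {f : ℍ → ℂ} :
    f ∈ Mset k ↔ (∀ γ : SL(2, ℤ), f ∣[k] γ = f) ∧ ∃ p, HasQSeries f p := by
  rw [mem_Mset_iff_exists]
  constructor
  · rintro ⟨F, rfl⟩
    exact ⟨fun γ => F.slash_action_eq' _ ⟨γ, rfl⟩, _, F.hasQSeries⟩
  · rintro ⟨hslash, p, hp⟩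
    refine ⟨⟨⟨f, fun _ ⟨γ, hγ⟩ => hγ ▸ hslash γ⟩, hp.mdifferentiable, fun {c} hc => ?_⟩, rfl⟩
    rw [Subgroup.IsArithmetic.isCusp_iff_isCusp_SL2Z] at hc
    rw [OnePoint.isBoundedAt_iff_forall_SL2Z hc]
    intro γ _
    change IsBoundedAtImInfty (f ∣[k] γ)
    rw [hslash γ]
    exact hp.isBoundedAtImInfty

namespace Mset

variable {k l : ℤ} {f g : ℍ → ℂ}

lemma exists_hasQSeries (hf : f ∈ Mset k) : ∃ p, HasQSeries f p := (mem_Mset_iff.mp hf).2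

lemma add (hf : f ∈ Mset k) (hg : g ∈ Mset k) : (fun z => f z + g z) ∈ Mset k := by
  rw [mem_Mset_iff_exists] at *
  obtain ⟨F, rfl⟩ := hf
  obtain ⟨G, rfl⟩ := hg
  exact ⟨F + G, rfl⟩

lemma sub (hf : f ∈ Mset k) (hg : g ∈ Mset k) : (fun z => f z - g z) ∈ Mset k := by
  rw [mem_Mset_iff_exists] at *
  obtain ⟨F, rfl⟩ := hf
  obtain ⟨G, rfl⟩ := hg
  exact ⟨F - G, rfl⟩

lemma const_mul (c : ℂ) (hf : f ∈ Mset k) : (fun z => c * f z) ∈ Mset k := by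
  rw [mem_Mset_iff_exists] at *
  obtain ⟨F, rfl⟩ := hf
  exact ⟨c • F, rfl⟩

lemma mul (hf : f ∈ Mset k) (hg : g ∈ Mset l) : (fun z => f z * g z) ∈ Mset (k + l) := by
  rw [mem_Mset_iff_exists] at *
  obtain ⟨F, rfl⟩ := hf
  obtain ⟨G, rfl⟩ := hg
  exact ⟨F.mul G, rfl⟩

lemma eq_zero_of_coeff (hf : f ∈ Mset k) {p : PowerSeries ℂ} (hp : HasQSeries f p)
    (h : ∀ n : ℕ, 12 * (n : ℤ) ≤ max k 0 → p.coeff n = 0) (z : ℍ) : f z = 0 := by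
  obtain ⟨F, rfl⟩ := mem_Mset_iff_exists.mp hf
  obtain rfl := hp.unique F.hasQSeries
  have : F = 0 := by
    apply ModularForm.sturm_bound_levelOne
    rw [← ENat.add_one_le_iff (ENat.natCast_ne_top _)]
    exact_mod_cast PowerSeries.nat_le_order _ _ fun n hn => h n (by omega)
  simp [this]

end Mset

lemma tsum_pnat_eq_tsum_nat_succ (z : ℍ) (k : ℕ) :
    ∑' n : ℕ+, (ArithmeticFunction.sigma k n : ℂ) * cexp (2 * π * Complex.I * z) ^ (n : ℕ) =
      ∑' n : ℕ, (ArithmeticFunction.sigma k (n + 1) : ℂ) * qexp z ^ (n + 1) :=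
  tsum_pnat_eq_tsum_succ
    (f := fun n => (ArithmeticFunction.sigma k n : ℂ) * cexp (2 * π * Complex.I * z) ^ n)

lemma Eis_eq_E {k : ℕ} (hk : 3 ≤ k) (hk2 : Even k) : Eis k = ModularForm.E hk := by
  ext z
  rw [EisensteinSeries.q_expansion_bernoulli hk hk2 z, Eis, ← tsum_pnat_eq_tsum_nat_succ]
  simp

lemma Eis_two_eq_E2 : Eis 2 = EisensteinSeries.E2 := by
  ext z
  rw [EisensteinSeries.E2_eq_tsum_cexp, Eis]
  have := tsum_pnat_eq_tsum_nat_succ z 1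
  rw [this]
  norm_num [bernoulli_two]

lemma Eis_four_eq : Eis 4 = ModularForm.E₄ := Eis_eq_E _ ⟨2, rfl⟩

lemma Eis_six_eq : Eis 6 = ModularForm.E₆ := Eis_eq_E _ ⟨3, rfl⟩

lemma Eis_four_mem : Eis 4 ∈ Mset 4 := mem_Mset_iff_exists.mpr ⟨_, Eis_four_eq.symm⟩

lemma Eis_six_mem : Eis 6 ∈ Mset 6 := mem_Mset_iff_exists.mpr ⟨_, Eis_six_eq.symm⟩

lemma exists_hasQSeries_Eis_two : ∃ p, HasQSeries (Eis 2) p ∧ p.coeff 0 = 1 := by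
  refine ⟨PowerSeries.mk fun m => if m = 0 then 1 else -24 * ArithmeticFunction.sigma 1 m,
    fun z => ?_, by simp⟩
  rw [Eis_two_eq_E2]
  simpa [qexp] using EisensteinSeries.hasSum_qExpansion_E2 (z := z)

lemma exists_hasQSeries_Eis_four : ∃ p, HasQSeries (Eis 4) p ∧ p.coeff 0 = 1 :=
  ⟨qExpansion 1 ModularForm.E₄, by rw [Eis_four_eq]; exact ModularForm.E₄.hasQSeries,
    EisensteinSeries.E_qExpansion_coeff_zero _ ⟨2, rfl⟩⟩

lemma exists_hasQSeries_Eis_six : ∃ p, HasQSeries (Eis 6) p ∧ p.coeff 0 = 1 :=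
  ⟨qExpansion 1 ModularForm.E₆, by rw [Eis_six_eq]; exact ModularForm.E₆.hasQSeries,
    EisensteinSeries.E_qExpansion_coeff_zero _ ⟨3, rfl⟩⟩

lemma Disc_eq_discriminant : Disc = CuspForm.discriminant := by
  ext z
  rw [Disc, Eis_four_eq, Eis_six_eq]
  exact (ModularForm.discriminant_eq_E₄_cube_sub_E₆_sq z).symm

lemma Disc_ne_zero (z : ℍ) : Disc z ≠ 0 := by
  rw [Disc_eq_discriminant]
  exact ModularForm.discriminant_ne_zero z

lemma exists_hasQSeries_Disc :
    ∃ p : PowerSeries ℂ, HasQSeries Disc (PowerSeries.X * p) ∧ p.coeff 0 = 1 := by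
  have h : HasQSeries Disc (qExpansion 1 ModularForm.discriminant) := by
    rw [Disc_eq_discriminant]
    exact (CuspForm.toModularFormₗ CuspForm.discriminant).hasQSeries
  have h0 : PowerSeries.X ∣ qExpansion 1 ModularForm.discriminant := by
    rw [PowerSeries.X_dvd_iff]
    have := CuspFormClass.qExpansion_coeff_zero CuspForm.discriminant one_pos
      one_mem_strictPeriods_SL
    simpa using this
  obtain ⟨p, hp⟩ := h0
  refine ⟨p, hp ▸ h, ?_⟩
  rw [← ModularForm.discriminant_qExpansion_coeff_one, hp, PowerSeries.coeff_succ_X_mul]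

lemma Mset.div_Disc {k : ℤ} {f : ℍ → ℂ} (hf : f ∈ Mset k) {p : PowerSeries ℂ}
    (hp : HasQSeries f p) (h0 : p.coeff 0 = 0) : (fun z => f z / Disc z) ∈ Mset (k - 12) := by
  obtain ⟨F, rfl⟩ := mem_Mset_iff_exists.mp hf
  obtain rfl := hp.unique F.hasQSeries
  exact mem_Mset_iff_exists.mpr
    ⟨CuspForm.discriminantEquiv (ModularForm.toCuspForm F h0), by
      ext z
      rw [CuspForm.discriminantEquiv_apply, Disc_eq_discriminant]; rfl⟩

section Derivation

variable {f g : ℍ → ℂ}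

lemma qderiv_add (hf : MDifferentiable 𝓘(ℂ) 𝓘(ℂ) f) (hg : MDifferentiable 𝓘(ℂ) 𝓘(ℂ) g) (z : ℍ) :
    qderiv (fun t => f t + g t) z = qderiv f z + qderiv g z := by
  simp only [qderiv_eq_normalizedDerivOfComplex]
  exact congrFun (Derivative.normalizedDerivOfComplex_add f g hf hg) z

lemma qderiv_sub (hf : MDifferentiable 𝓘(ℂ) 𝓘(ℂ) f) (hg : MDifferentiable 𝓘(ℂ) 𝓘(ℂ) g) (z : ℍ) :
    qderiv (fun t => f t - g t) z = qderiv f z - qderiv g z := by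
  simp only [qderiv_eq_normalizedDerivOfComplex]
  exact congrFun (Derivative.normalizedDerivOfComplex_sub f g hf hg) z

lemma qderiv_mul (hf : MDifferentiable 𝓘(ℂ) 𝓘(ℂ) f) (hg : MDifferentiable 𝓘(ℂ) 𝓘(ℂ) g) (z : ℍ) :
    qderiv (fun t => f t * g t) z = qderiv f z * g z + f z * qderiv g z := by
  simp only [qderiv_eq_normalizedDerivOfComplex]
  exact congrFun (Derivative.normalizedDerivOfComplex_mul f g hf hg) z

lemma qderiv_const_mul (c : ℂ) (hf : MDifferentiable 𝓘(ℂ) 𝓘(ℂ) f) (z : ℍ) :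
    qderiv (fun t => c * f t) z = c * qderiv f z := by
  simp only [qderiv_eq_normalizedDerivOfComplex]
  exact congrFun (Derivative.normalizedDerivOfComplex_smul c f hf) z

end Derivation

lemma serre_eq_serreDerivative (k : ℤ) (f : ℍ → ℂ) :
    serre k f = Derivative.serreDerivative k f := by
  funext z
  simp [serre, qderiv_eq_normalizedDerivOfComplex, Eis_two_eq_E2, div_eq_mul_inv]

lemma HasQSeries.serre {f : ℍ → ℂ} {p e : PowerSeries ℂ} (hf : HasQSeries f p)
    (he : HasQSeries (Eis 2) e) (k : ℤ) :
    HasQSeries (serre k f) (eulerOp p - PowerSeries.C ((k : ℂ) / 12) * e * p) :=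
  hf.qderiv.sub ((he.const_mul _).mul hf)

lemma Mset.mdifferentiable {k : ℤ} {f : ℍ → ℂ} (hf : f ∈ Mset k) :
    MDifferentiable 𝓘(ℂ) 𝓘(ℂ) f :=
  let ⟨_, hp⟩ := Mset.exists_hasQSeries hf
  hp.mdifferentiable

lemma Mset.serre {k : ℤ} {f : ℍ → ℂ} (hf : f ∈ Mset k) : serre k f ∈ Mset (k + 2) := by
  obtain ⟨p, hp⟩ := Mset.exists_hasQSeries hf
  obtain ⟨e, he, -⟩ := exists_hasQSeries_Eis_two
  refine mem_Mset_iff.mpr ⟨fun γ => ?_, _, hp.serre he k⟩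
  rw [serre_eq_serreDerivative]
  exact Derivative.serreDerivative_slash_invariant hp.mdifferentiable ((mem_Mset_iff.mp hf).1 γ)

/-- Two modular forms of weight less than `12` with equal constant terms agree. -/
lemma Mset.eq_of_coeff_zero {k : ℤ} {f g : ℍ → ℂ} (hk : k < 12) (hf : f ∈ Mset k) (hg : g ∈ Mset k)
    {p r : PowerSeries ℂ} (hp : HasQSeries f p) (hr : HasQSeries g r)
    (h : p.coeff 0 = r.coeff 0) (z : ℍ) : f z = g z := by
  refine sub_eq_zero.mp (Mset.eq_zero_of_coeff (Mset.sub hf hg) (hp.sub hr) (fun n hn => ?_) z)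
  obtain rfl : n = 0 := by omega
  rw [map_sub, h, sub_self]

lemma constantCoeff_eulerOp (p : PowerSeries ℂ) : (eulerOp p).constantCoeff = 0 := by
  simp [eulerOp]

lemma serre_Eis_four (z : ℍ) : serre 4 (Eis 4) z = -(1 / 3) * Eis 6 z := by
  obtain ⟨e, he, he0⟩ := exists_hasQSeries_Eis_two
  obtain ⟨p, hp, hp0⟩ := exists_hasQSeries_Eis_four
  obtain ⟨r, hr, hr0⟩ := exists_hasQSeries_Eis_six
  refine Mset.eq_of_coeff_zero (by norm_num) (Mset.serre Eis_four_mem)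
    (Mset.const_mul _ Eis_six_mem) (hp.serre he 4) (hr.const_mul _) ?_ z
  rw [PowerSeries.coeff_zero_eq_constantCoeff_apply] at he0 hp0 hr0
  norm_num [constantCoeff_eulerOp, he0, hp0, hr0]

lemma serre_Eis_six (z : ℍ) : serre 6 (Eis 6) z = -(1 / 2) * (Eis 4 z * Eis 4 z) := by
  obtain ⟨e, he, he0⟩ := exists_hasQSeries_Eis_two
  obtain ⟨p, hp, hp0⟩ := exists_hasQSeries_Eis_four
  obtain ⟨r, hr, hr0⟩ := exists_hasQSeries_Eis_six
  refine Mset.eq_of_coeff_zero (by norm_num) (Mset.serre Eis_six_mem)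
    (Mset.const_mul _ (Mset.mul (k := 4) Eis_four_mem Eis_four_mem)) (hr.serre he 6)
    ((hp.mul hp).const_mul _) ?_ z
  rw [PowerSeries.coeff_zero_eq_constantCoeff_apply] at he0 hp0 hr0
  norm_num [constantCoeff_eulerOp, he0, hp0, hr0]

lemma Eis_two_slash (γ : SL(2, ℤ)) : Eis 2 ∣[(2 : ℤ)] γ =
    Eis 2 + (12 * (2 * π * Complex.I)⁻¹ * (γ 1 0 : ℂ)) • ((fun _ : ℍ => (1 : ℂ)) ∣[(1 : ℤ)] γ) := by
  rw [Eis_two_eq_E2, EisensteinSeries.E2_slash_action]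
  funext z
  have hpi : (π : ℂ) ≠ 0 := by exact_mod_cast Real.pi_ne_zero
  simp only [Pi.sub_apply, Pi.add_apply, Pi.smul_apply, smul_eq_mul, EisensteinSeries.D2,
    riemannZeta_two, ModularForm.SL_slash_apply]
  have hI := I_sq
  have := UpperHalfPlane.denom_ne_zero γ z
  field_simp
  grind

lemma normalizedDeriv_one_slash (γ : SL(2, ℤ)) (z : ℍ) :
    Derivative.normalizedDerivOfComplex ((fun _ : ℍ => (1 : ℂ)) ∣[(1 : ℤ)] γ) z =
      -((2 * π * Complex.I)⁻¹ * (γ 1 0 : ℂ)) * (((fun _ : ℍ => (1 : ℂ)) ∣[(1 : ℤ)] γ) z) ^ 2 := by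
  rw [Derivative.normalizedDerivOfComplex_SL_slash mdifferentiable_const,
    Derivative.normalizedDerivOfComplex_const]
  simp [ModularForm.SL_slash_apply, SlashAction.zero_slash]
  ring

/-- The function `E_2' - E_2² / 12` is modular of weight `4`. -/
lemma qderiv_Eis_two_sub_mem :
    (fun z => qderiv (Eis 2) z - (1 / 12) * (Eis 2 z * Eis 2 z)) ∈ Mset 4 := by
  obtain ⟨e, he, -⟩ := exists_hasQSeries_Eis_two
  refine mem_Mset_iff.mpr ⟨fun γ => ?_, _, he.qderiv.sub ((he.mul he).const_mul _)⟩
  have hj : MDifferentiable 𝓘(ℂ) 𝓘(ℂ) ((fun _ : ℍ => (1 : ℂ)) ∣[(1 : ℤ)] γ) :=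
    MDifferentiable.slash mdifferentiable_const 1 γ
  have hE := Eis_two_slash γ
  have hEE := ModularForm.mul_slash_SL2 2 2 γ (Eis 2) (Eis 2)
  have hD := Derivative.normalizedDerivOfComplex_SL_slash (k := 2) (γ := γ) he.mdifferentiable
  rw [hE, Derivative.normalizedDerivOfComplex_add _ _ he.mdifferentiable (hj.const_smul _),
    Derivative.normalizedDerivOfComplex_smul _ _ hj, ← qderiv_eq_normalizedDerivOfComplex] at hD
  funext z
  have hDz := congrFun hD z
  have hEEz := congrFun hEE z
  simp only [Pi.add_apply, Pi.sub_apply, Pi.smul_apply, Pi.mul_apply, smul_eq_mul, hE,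
    normalizedDeriv_one_slash, ModularForm.SL_slash_apply, Int.reduceAdd] at hDz hEEz ⊢
  have hd : ((denom γ z) ^ (-1 : ℤ) : ℂ) = 1 / denom γ z := by simp
  simp only [hd] at hDz hEEz
  push_cast at hDz
  linear_combination -hDz - (1 / 12) * hEEz

/-- Ramanujan's formula for the derivative of `E_2`. -/
lemma qderiv_Eis_two (z : ℍ) : qderiv (Eis 2) z = 1 / 12 * (Eis 2 z * Eis 2 z - Eis 4 z) := by
  obtain ⟨e, he, he0⟩ := exists_hasQSeries_Eis_two
  obtain ⟨p, hp, hp0⟩ := exists_hasQSeries_Eis_four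
  have := Mset.eq_of_coeff_zero (by norm_num) qderiv_Eis_two_sub_mem
    (Mset.const_mul (-(1 / 12)) Eis_four_mem) (he.qderiv.sub ((he.mul he).const_mul _))
    (hp.const_mul _) ?_ z
  · linear_combination this
  · rw [PowerSeries.coeff_zero_eq_constantCoeff_apply] at he0 hp0
    norm_num [constantCoeff_eulerOp, he0, hp0]

/-- The forms `1` and `E_2` are linearly independent over the graded ring of modular forms. -/
lemma Mset.eq_zero_of_add_Eis_two_mul {k : ℤ} {f g : ℍ → ℂ} (hf : f ∈ Mset k)
    (hg : g ∈ Mset (k - 2)) (h : ∀ z, f z + Eis 2 z * g z = 0) : f = 0 ∧ g = 0 := by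
  suffices hg0 : ∀ z, g z = 0 from
    ⟨funext fun z => by simpa [hg0 z] using h z, funext hg0⟩
  intro z
  have hfS := congrFun ((mem_Mset_iff.mp hf).1 ModularGroup.S) z
  have hgS := congrFun ((mem_Mset_iff.mp hg).1 ModularGroup.S) z
  have hES := congrFun (Eis_two_slash ModularGroup.S) z
  have hmul := congrFun (ModularForm.mul_slash_SL2 2 (k - 2) ModularGroup.S (Eis 2) g) z
  have hS : (f + Eis 2 * g) ∣[k] ModularGroup.S = 0 := by
    rw [show f + Eis 2 * g = 0 from funext h, SlashAction.zero_slash]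
  have hSz := congrFun hS z
  rw [SlashAction.add_slash, Pi.add_apply, hfS] at hSz
  rw [add_sub_cancel, Pi.mul_apply, hgS, hES] at hmul
  rw [hmul] at hSz
  have hj : (12 * (2 * π * Complex.I)⁻¹ * (ModularGroup.S 1 0 : ℂ)) *
      ((fun _ : ℍ => (1 : ℂ)) ∣[(1 : ℤ)] ModularGroup.S) z ≠ 0 := by
    have hS10 : ModularGroup.S 1 0 = 1 := rfl
    simp [ModularForm.SL_slash_apply, hS10, UpperHalfPlane.ne_zero]
  refine (mul_eq_zero.mp ?_).resolve_left hj
  simp only [Pi.add_apply, Pi.smul_apply, smul_eq_mul, Pi.zero_apply] at hSz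
  linear_combination hSz - h z

/-- The map `(h₀, h₁) ↦ h₀ + E_2 h₁` whose image is the space of quasimodular forms of depth `1`. -/
noncomputable def quasimodularMap (w : ℤ) :
    ModularForm 𝒮ℒ w × ModularForm 𝒮ℒ (w - 2) →ₗ[ℂ] (ℍ → ℂ) where
  toFun h z := h.1 z + Eis 2 z * h.2 z
  map_add' a b := by
    funext z
    simp only [Prod.fst_add, Prod.snd_add, _root_.add_apply, Pi.add_apply]
    ring
  map_smul' c a := by
    funext z
    simp only [Prod.smul_fst, Prod.smul_snd, _root_.smul_apply, Pi.smul_apply,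
      smul_eq_mul, RingHom.id_apply]
    ring

lemma quasimodularMap_injective (w : ℤ) : Function.Injective (quasimodularMap w) := by
  refine (injective_iff_map_eq_zero _).mpr fun h hh => ?_
  obtain ⟨h0, h1⟩ := Mset.eq_zero_of_add_Eis_two_mul (mem_Mset_iff_exists.mpr ⟨h.1, rfl⟩)
    (mem_Mset_iff_exists.mpr ⟨h.2, rfl⟩) (congrFun hh)
  exact Prod.ext (DFunLike.coe_injective h0) (DFunLike.coe_injective h1)

lemma mem_range_quasimodularMap_iff {w : ℤ} {f : ℍ → ℂ} :
    f ∈ LinearMap.range (quasimodularMap w) ↔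
      ∃ g ∈ Mset w, ∃ h ∈ Mset (w - 2), ∀ z, f z = g z + Eis 2 z * h z := by
  simp only [LinearMap.mem_range, mem_Mset_iff_exists]
  constructor
  · rintro ⟨h, rfl⟩
    exact ⟨_, ⟨h.1, rfl⟩, _, ⟨h.2, rfl⟩, fun z => rfl⟩
  · rintro ⟨_, ⟨G, rfl⟩, _, ⟨H, rfl⟩, hf⟩
    exact ⟨(G, H), funext fun z => (hf z).symm⟩

lemma QM_one_eq_range (w : ℤ) : QM w 1 = LinearMap.range (quasimodularMap w) := by
  refine le_antisymm (Submodule.span_le.mpr ?_) fun f hf => Submodule.subset_span ?_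
  · rintro f ⟨h, hh, hf⟩
    refine mem_range_quasimodularMap_iff.mpr
      ⟨h 0, by simpa using hh 0 zero_le_one, h 1, by simpa using hh 1 le_rfl, fun z => ?_⟩
    simp [hf, Finset.sum_range_succ]
  · obtain ⟨g, hg, h, hh, hf⟩ := mem_range_quasimodularMap_iff.mp hf
    refine ⟨fun ℓ => if ℓ = 0 then g else h, fun ℓ hℓ => ?_, fun z => ?_⟩
    · interval_cases ℓ
      · simpa using hg
      · simpa using hh
    · simp [Finset.sum_range_succ, hf]

lemma mem_QM_one_iff {w : ℤ} {f : ℍ → ℂ} :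
    f ∈ QM w 1 ↔ ∃ g ∈ Mset w, ∃ h ∈ Mset (w - 2), ∀ z, f z = g z + Eis 2 z * h z := by
  rw [QM_one_eq_range, mem_range_quasimodularMap_iff]

lemma finrank_modularForm {k : ℕ} (hk : Even k) : Module.finrank ℂ (ModularForm 𝒮ℒ k) =
    if k ≡ 2 [MOD 12] then k / 12 else k / 12 + 1 := by
  refine Module.finrank_eq_of_rank_eq ?_
  rw [ModularForm.dimension_level_one k hk]

lemma dimQM_one {w : ℤ} (hw6 : w % 6 = 0) (hw : 6 ≤ w) : (dimQM w 1 : ℤ) = w / 6 + 1 := by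
  rw [dimQM, QM_one_eq_range, LinearMap.finrank_range_of_inj (quasimodularMap_injective w),
    Module.finrank_prod]
  obtain ⟨m, rfl⟩ : ∃ m : ℕ, w = (m : ℤ) + 2 := ⟨(w - 2).toNat, by omega⟩
  have hm : Even m := by grind
  have h₁ := finrank_modularForm hm
  have h₀ := finrank_modularForm (hm.add even_two)
  simp only [Nat.ModEq] at h₀ h₁
  push_cast at h₀
  rw [add_sub_cancel_right, h₁, h₀]
  grind

lemma eulerOp_X_pow_mul (n : ℕ) (u : PowerSeries ℂ) :
    eulerOp (PowerSeries.X ^ n * u) =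
      PowerSeries.X ^ n * ((n : PowerSeries ℂ) * u + eulerOp u) := by
  ext k
  rw [coeff_eulerOp]
  rcases lt_or_ge k n with h | h
  · rw [PowerSeries.coeff_X_pow_mul', PowerSeries.coeff_X_pow_mul', if_neg h.not_ge,
      if_neg h.not_ge, mul_zero]
  · obtain ⟨j, rfl⟩ := Nat.exists_eq_add_of_le' h
    rw [PowerSeries.coeff_X_pow_mul, PowerSeries.coeff_X_pow_mul, map_add, coeff_eulerOp,
      ← map_natCast (PowerSeries.C (R := ℂ)), PowerSeries.coeff_C_mul]
    push_cast
    ring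

lemma exists_eq_X_pow_mul {p : PowerSeries ℂ} (hp : p ≠ 0) :
    ∃ (n : ℕ) (u : PowerSeries ℂ), p = PowerSeries.X ^ n * u ∧ u.constantCoeff ≠ 0 :=
  ⟨_, _, (PowerSeries.X_pow_order_mul_divXPowOrder).symm,
    mt PowerSeries.constantCoeff_divXPowOrder_eq_zero_iff.mp hp⟩

/-- A power series form of the fact that `θ (b / p) = -1 / 12` has no solutions. -/
lemma eq_zero_of_eulerOp_wronskian {p b : PowerSeries ℂ}
    (h : p * eulerOp b - eulerOp p * b + PowerSeries.C (1 / 12) * (p * p) = 0) : p = 0 := by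
  by_contra hp
  obtain ⟨ν, u, rfl, hu⟩ := exists_eq_X_pow_mul hp
  rcases eq_or_ne b 0 with rfl | hb
  · simp [eulerOp, hp] at h
  obtain ⟨l, v, rfl, hv⟩ := exists_eq_X_pow_mul hb
  have hX : ∀ n : ℕ, (PowerSeries.X : PowerSeries ℂ) ^ n ≠ 0 := fun n =>
    pow_ne_zero n PowerSeries.X_ne_zero
  rw [eulerOp_X_pow_mul, eulerOp_X_pow_mul] at h
  rcases le_or_gt ν l with hl | hl
  · obtain ⟨d, rfl⟩ := Nat.exists_eq_add_of_le hl
    have hfactor : PowerSeries.X ^ (2 * ν) * (PowerSeries.X ^ d *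
        ((d : PowerSeries ℂ) * (u * v) + u * eulerOp v - eulerOp u * v) + PowerSeries.C (1 / 12) * (u * u)) = 0 := by
      rw [← h]
      push_cast
      ring
    have hc := congrArg PowerSeries.constantCoeff ((mul_eq_zero.mp hfactor).resolve_left (hX _))
    rcases eq_or_ne d 0 with rfl | hd <;> simp [constantCoeff_eulerOp, *] at hc
  · obtain ⟨d, rfl⟩ := Nat.exists_eq_add_of_le hl.le
    have hd : d ≠ 0 := by omega
    have hfactor : PowerSeries.X ^ (2 * l + d) * (u * eulerOp v - eulerOp u * v -
        (d : PowerSeries ℂ) * (u * v) + PowerSeries.X ^ d * (PowerSeries.C (1 / 12) * (u * u))) = 0 := by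
      rw [← h]
      push_cast
      ring
    have hc := congrArg PowerSeries.constantCoeff ((mul_eq_zero.mp hfactor).resolve_left (hX _))
    simp [constantCoeff_eulerOp, hd, hu, hv] at hc

/-- The derivative of `g + E_2 b`. -/
lemma qderiv_add_Eis_two_mul {g b : ℍ → ℂ} (hg : MDifferentiable 𝓘(ℂ) 𝓘(ℂ) g)
    (hb : MDifferentiable 𝓘(ℂ) 𝓘(ℂ) b) (z : ℍ) :
    qderiv (fun t => g t + Eis 2 t * b t) z = qderiv g z +
      (1 / 12 * (Eis 2 z * Eis 2 z - Eis 4 z) * b z + Eis 2 z * qderiv b z) := by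
  obtain ⟨e, he, -⟩ := exists_hasQSeries_Eis_two
  have hE := he.mdifferentiable
  have hEb : MDifferentiable 𝓘(ℂ) 𝓘(ℂ) (fun t => Eis 2 t * b t) := hE.mul hb
  rw [qderiv_add hg hEb, qderiv_mul hE hb, qderiv_Eis_two]

/-- A quasimodular form of weight `k` and depth `1` is determined by its Fourier coefficients of
index at most `k / 6`. -/
lemma eq_zero_of_mem_QM_one {k : ℤ} (hk : 0 ≤ k) {f : ℍ → ℂ} (hf : f ∈ QM k 1) {p : PowerSeries ℂ}
    (hp : HasQSeries f p) (h : ∀ n : ℕ, 6 * (n : ℤ) ≤ k → p.coeff n = 0) (z : ℍ) : f z = 0 := by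
  obtain ⟨g, hg, b, hb, hfgb⟩ := mem_QM_one_iff.mp hf
  obtain ⟨r, hr⟩ := Mset.exists_hasQSeries hb
  have hgd := Mset.mdifferentiable hg
  have hbd := Mset.mdifferentiable hb
  set W : ℍ → ℂ := fun z => f z * qderiv b z - qderiv f z * b z + 1 / 12 * (f z * f z) with hWdef
  have hWs : HasQSeries W (p * eulerOp r - eulerOp p * r + PowerSeries.C (1 / 12) * (p * p)) :=
    ((hp.mul hr.qderiv).sub (hp.qderiv.mul hr)).add ((hp.mul hp).const_mul _)
  have hW : W ∈ Mset (2 * k) := by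
    have h₁ : (fun z => g z * serre (k - 2) b z) ∈ Mset (2 * k) :=
      (by ring : k + (k - 2 + 2) = 2 * k) ▸ Mset.mul hg (Mset.serre hb)
    have h₂ : (fun z => b z * serre k g z) ∈ Mset (2 * k) :=
      (by ring : k - 2 + (k + 2) = 2 * k) ▸ Mset.mul hb (Mset.serre hg)
    have h₃ : (fun z => Eis 4 z * (b z * b z)) ∈ Mset (2 * k) :=
      (by ring : 4 + (k - 2 + (k - 2)) = 2 * k) ▸ Mset.mul Eis_four_mem (Mset.mul hb hb)
    have h₄ : (fun z => g z * g z) ∈ Mset (2 * k) := two_mul k ▸ Mset.mul hg hg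
    convert Mset.add (Mset.sub h₁ h₂) (Mset.const_mul (1 / 12) (Mset.add h₃ h₄)) using 1
    funext z
    simp only [hWdef, funext hfgb, qderiv_add_Eis_two_mul hgd hbd, serre]
    push_cast
    ring
  have hdvd : ∀ {n : ℕ} {s : PowerSeries ℂ}, PowerSeries.X ^ n ∣ s →
      PowerSeries.X ^ n ∣ eulerOp s := by
    rintro n _ ⟨u, rfl⟩
    exact eulerOp_X_pow_mul n u ▸ dvd_mul_right _ _
  have hp' : PowerSeries.X ^ (k / 6 + 1).toNat ∣ p :=
    PowerSeries.X_pow_dvd_iff.mpr fun n hn => h n (by omega)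
  have hW0 := Mset.eq_zero_of_coeff hW hWs fun n hn =>
    PowerSeries.X_pow_dvd_iff.mp (((hp'.mul_right _).sub ((hdvd hp').mul_right _)).add
      ((hp'.mul_right p).mul_left _)) n (by omega)
  have hzero : HasQSeries W 0 := fun z => by simp [hW0 z]
  rw [eq_zero_of_eulerOp_wronskian (hWs.unique hzero)] at hp
  exact hp.eq_zero z

lemma hasQSeries_of_hasSum {f : ℍ → ℂ} {a : ℕ → ℂ} {ν : ℕ}
    (h : ∀ z, HasSum (fun n : ℕ => a n * qexp z ^ (ν + n)) (f z)) :
    HasQSeries f (PowerSeries.X ^ ν * PowerSeries.mk a) := fun z => by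
  rw [← hasSum_nat_add_iff' ν, Finset.sum_eq_zero, sub_zero]
  · simpa only [PowerSeries.coeff_X_pow_mul, PowerSeries.coeff_mk, add_comm ν] using h z
  · intro n hn
    rw [PowerSeries.coeff_X_pow_mul', if_neg (by simpa using hn), zero_mul]

lemma exists_hasQSeries_of_mem_QM_one {k : ℤ} {f : ℍ → ℂ} (hf : f ∈ QM k 1) :
    ∃ p, HasQSeries f p := by
  obtain ⟨g, hg, b, hb, hfgb⟩ := mem_QM_one_iff.mp hf
  obtain ⟨p, hp⟩ := Mset.exists_hasQSeries hg
  obtain ⟨r, hr⟩ := Mset.exists_hasQSeries hb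
  obtain ⟨e, he, -⟩ := exists_hasQSeries_Eis_two
  exact ⟨_, funext hfgb ▸ hp.add (he.mul hr)⟩

/-- The series of `E_4 ∂_{w-1} f + ((w-1)/12) E_6 f` is again divisible by `q ^ n` when that of `f`
is, and the coefficient of `q ^ n` is multiplied by `n`. -/
lemma exists_hasQSeries_kdown {f : ℍ → ℂ} {u : PowerSeries ℂ} {n : ℕ} (w : ℤ)
    (hf : HasQSeries f (PowerSeries.X ^ n * u)) :
    ∃ s : PowerSeries ℂ, HasQSeries
        (fun z => Eis 4 z * serre (w - 1) f z + ((w : ℂ) - 1) / 12 * Eis 6 z * f z)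
        (PowerSeries.X ^ n * s) ∧ s.constantCoeff = n * u.constantCoeff := by
  obtain ⟨e, he, he0⟩ := exists_hasQSeries_Eis_two
  obtain ⟨p, hp, hp0⟩ := exists_hasQSeries_Eis_four
  obtain ⟨r, hr, hr0⟩ := exists_hasQSeries_Eis_six
  rw [PowerSeries.coeff_zero_eq_constantCoeff_apply] at he0 hp0 hr0
  refine ⟨p * ((n : PowerSeries ℂ) * u + eulerOp u -
    PowerSeries.C (((w - 1 : ℤ) : ℂ) / 12) * e * u) +
    PowerSeries.C (((w : ℂ) - 1) / 12) * r * u, ?_, ?_⟩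
  · convert (hp.mul (hf.serre he (w - 1))).add ((hr.const_mul (((w : ℂ) - 1) / 12)).mul hf) using 1
    rw [eulerOp_X_pow_mul]
    ring
  · simp [constantCoeff_eulerOp, he0, hp0, hr0]

/-- The operator `K^down_w` maps forms of weight `w` and depth `1` that vanish at infinity to forms
of weight `w - 6` and depth `1`. -/
lemma kdown_mem_QM_one {w : ℤ} {f : ℍ → ℂ} (hf : f ∈ QM w 1) {p : PowerSeries ℂ}
    (hp : HasQSeries f p) (hp0 : p.constantCoeff = 0) :
    (fun z => (Eis 4 z * serre (w - 1) f z + ((w : ℂ) - 1) / 12 * Eis 6 z * f z) / Disc z) ∈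
      QM (w - 6) 1 := by
  obtain ⟨g, hg, b, hb, hfgb⟩ := mem_QM_one_iff.mp hf
  obtain ⟨r, hr⟩ := Mset.exists_hasQSeries hg
  obtain ⟨s, hs⟩ := Mset.exists_hasQSeries hb
  obtain ⟨e, he, he0⟩ := exists_hasQSeries_Eis_two
  obtain ⟨e₄, he₄, he₄0⟩ := exists_hasQSeries_Eis_four
  obtain ⟨e₆, he₆, he₆0⟩ := exists_hasQSeries_Eis_six
  rw [PowerSeries.coeff_zero_eq_constantCoeff_apply] at he0 he₄0 he₆0
  have hrs : r.constantCoeff + s.constantCoeff = 0 := by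
    have hpe : p = r + e * s := hp.unique (funext hfgb ▸ hr.add (he.mul hs))
    rw [← hp0, hpe]
    simp [he0]
  set c : ℂ := ((w : ℂ) - 1) / 12 with hc
  have hA : (fun z => Eis 4 z * (serre w g z - 1 / 12 * (Eis 4 z * b z)) + c * (Eis 6 z * g z)) ∈
      Mset (w + 6) := by
    have h₁ : (fun z => Eis 4 z * b z) ∈ Mset (w + 2) :=
      (by ring : 4 + (w - 2) = w + 2) ▸ Mset.mul Eis_four_mem hb
    have h₂ : (fun z => Eis 6 z * g z) ∈ Mset (w + 6) := add_comm 6 w ▸ Mset.mul Eis_six_mem hg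
    exact Mset.add ((by ring : 4 + (w + 2) = w + 6) ▸ Mset.mul Eis_four_mem
      (Mset.sub (Mset.serre hg) (Mset.const_mul _ h₁))) (Mset.const_mul c h₂)
  have hB : (fun z => Eis 4 z * (serre (w - 2) b z + 1 / 12 * g z) + c * (Eis 6 z * b z)) ∈
      Mset (w + 4) := by
    have h₁ : serre (w - 2) b ∈ Mset w := by simpa using Mset.serre hb
    have h₂ : (fun z => Eis 6 z * b z) ∈ Mset (w + 4) :=
      (by ring : 6 + (w - 2) = w + 4) ▸ Mset.mul Eis_six_mem hb
    exact Mset.add (add_comm 4 w ▸ Mset.mul Eis_four_mem (Mset.add h₁ (Mset.const_mul _ hg)))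
      (Mset.const_mul c h₂)
  have hAD := Mset.div_Disc hA ((he₄.mul ((hr.serre he w).sub ((he₄.mul hs).const_mul _))).add
    ((he₆.mul hr).const_mul c)) (by
      rw [PowerSeries.coeff_zero_eq_constantCoeff_apply]
      simp only [map_add, map_sub, map_mul, PowerSeries.constantCoeff_C, constantCoeff_eulerOp,
        he0, he₄0, he₆0]
      linear_combination -(1 / 12) * hrs)
  have hBD := Mset.div_Disc hB ((he₄.mul ((hs.serre he (w - 2)).add (hr.const_mul _))).add
    ((he₆.mul hs).const_mul c)) (by
      rw [PowerSeries.coeff_zero_eq_constantCoeff_apply]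
      simp only [map_add, map_sub, map_mul, PowerSeries.constantCoeff_C, constantCoeff_eulerOp,
        he0, he₄0, he₆0]
      push_cast
      linear_combination (1 / 12) * hrs)
  refine mem_QM_one_iff.mpr ⟨_, (by ring : w + 6 - 12 = w - 6) ▸ hAD,
    _, (by ring : w + 4 - 12 = w - 6 - 2) ▸ hBD, fun z => ?_⟩
  simp only [funext hfgb, qderiv_add_Eis_two_mul hr.mdifferentiable hs.mdifferentiable, serre, hc]
  have := Disc_ne_zero z
  field_simp
  push_cast
  ring

lemma kdown_eq_of_isNormalizedExtremalQM {w : ℤ} (hw6 : w % 6 = 0) (hw : 12 ≤ w) {f g : ℍ → ℂ}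
    (hf : IsNormalizedExtremalQM w 1 f) (hg : IsNormalizedExtremalQM (w - 6) 1 g) (z : ℍ) :
    (Eis 4 z * serre (w - 1) f z + ((w : ℂ) - 1) / 12 * Eis 6 z * f z) / Disc z =
      (w : ℂ) / 6 * g z := by
  obtain ⟨m, rfl⟩ : ∃ m : ℕ, w = 6 * ((m : ℤ) + 1) := ⟨(w / 6 - 1).toNat, by omega⟩
  obtain ⟨hfQ, a, ha0, ha⟩ := hf
  obtain ⟨hgQ, b, hb0, hb⟩ := hg
  have hdf := dimQM_one hw6 (by omega)
  have hdg := dimQM_one (w := 6 * ((m : ℤ) + 1) - 6) (by omega) (by omega)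
  rw [show dimQM (6 * ((m : ℤ) + 1)) 1 - 1 = m + 1 by omega] at ha
  rw [show dimQM (6 * ((m : ℤ) + 1) - 6) 1 - 1 = m by omega] at hb
  have hfs := hasQSeries_of_hasSum ha
  have hgs := hasQSeries_of_hasSum hb
  have hK := kdown_mem_QM_one hfQ hfs (by simp)
  obtain ⟨s, hs, hs0⟩ := exists_hasQSeries_kdown (6 * ((m : ℤ) + 1)) hfs
  obtain ⟨t, ht⟩ := exists_hasQSeries_of_mem_QM_one hK
  obtain ⟨δ, hδ, hδ0⟩ := exists_hasQSeries_Disc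
  rw [PowerSeries.coeff_zero_eq_constantCoeff_apply] at hδ0
  have htδ : t * δ = PowerSeries.X ^ m * s := by
    have h := (ht.mul hδ).unique (by simpa only [div_mul_cancel₀ _ (Disc_ne_zero _)] using hs)
    refine mul_left_cancel₀ PowerSeries.X_ne_zero ?_
    linear_combination h
  obtain ⟨v, rfl⟩ : PowerSeries.X ^ m ∣ t := by
    have hu : IsUnit δ := PowerSeries.isUnit_iff_constantCoeff.mpr (by simp [hδ0])
    exact (hu.dvd_mul_right).mp ⟨s, htδ⟩
  have hv : v.constantCoeff = m + 1 := by
    have h : v * δ = s := mul_left_cancel₀ (pow_ne_zero m PowerSeries.X_ne_zero)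
      (by rw [← htδ, mul_assoc])
    rw [← h] at hs0
    simpa [hδ0, ha0, ← PowerSeries.coeff_zero_eq_constantCoeff_apply (PowerSeries.mk a)] using hs0
  refine sub_eq_zero.mp (eq_zero_of_mem_QM_one (by omega) (Submodule.sub_mem _ hK
    (Submodule.smul_mem _ _ hgQ)) (ht.sub (hgs.const_mul _)) (fun n hn => ?_) z)
  have hfactor : PowerSeries.X ^ m * v - PowerSeries.C (((6 * ((m : ℤ) + 1) : ℤ) : ℂ) / 6) *
      (PowerSeries.X ^ m * PowerSeries.mk b) = PowerSeries.X ^ m *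
      (v - PowerSeries.C (((6 * ((m : ℤ) + 1) : ℤ) : ℂ) / 6) * PowerSeries.mk b) := by ring
  rw [hfactor, PowerSeries.coeff_X_pow_mul']
  split_ifs with hmn
  · obtain rfl : n = m := by omega
    simp [hv, hb0, ← PowerSeries.coeff_zero_eq_constantCoeff_apply (PowerSeries.mk b)]
  · rfl

/-- The composition of `K^down_{w+6}` with its companion operator on solutions of
`∂_{w-1}² f = ((w²-1)/144) E_4 f`. -/
lemma kdown_kup_eq {w : ℤ} {f : ℍ → ℂ} {p : PowerSeries ℂ} (hp : HasQSeries f p)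
    (hode : ∀ z, serreIter (w - 1) 2 f z - ((w : ℂ) ^ 2 - 1) / 144 * Eis 4 z * f z = 0) (z : ℍ) :
    (Eis 4 z * serre (w + 5)
        (fun t => Eis 4 t * serre (w - 1) f t - ((w : ℂ) + 1) / 12 * Eis 6 t * f t) z +
      ((w : ℂ) + 5) / 12 * Eis 6 z *
        (Eis 4 z * serre (w - 1) f z - ((w : ℂ) + 1) / 12 * Eis 6 z * f z)) / Disc z =
      12 * ((w : ℂ) + 1) * ((w : ℂ) + 5) * f z := by
  obtain ⟨e, he, -⟩ := exists_hasQSeries_Eis_two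
  obtain ⟨r, hr, -⟩ := exists_hasQSeries_Eis_four
  obtain ⟨s, hs, -⟩ := exists_hasQSeries_Eis_six
  have hf' := hp.serre he (w - 1)
  have hs' := hs.const_mul (((w : ℂ) + 1) / 12)
  have hdiff : qderiv (fun t => Eis 4 t * serre (w - 1) f t -
      ((w : ℂ) + 1) / 12 * Eis 6 t * f t) z =
      qderiv (Eis 4) z * serre (w - 1) f z + Eis 4 z * qderiv (serre (w - 1) f) z -
      (((w : ℂ) + 1) / 12 * qderiv (Eis 6) z * f z +
        ((w : ℂ) + 1) / 12 * Eis 6 z * qderiv f z) := by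
    rw [qderiv_sub (hr.mul hf').mdifferentiable (hs'.mul hp).mdifferentiable,
      qderiv_mul hr.mdifferentiable hf'.mdifferentiable,
      qderiv_mul hs'.mdifferentiable hp.mdifferentiable,
      qderiv_const_mul _ hs.mdifferentiable]
  have h₂ := hode z
  have h₄ := serre_Eis_four z
  have h₆ := serre_Eis_six z
  have hD : Disc z ≠ 0 := Disc_ne_zero z
  rw [div_eq_iff hD, Disc]
  simp only [serreIter, Nat.cast_zero, Nat.cast_one, mul_zero, add_zero] at h₂
  rw [serre] at h₂ h₄ h₆ ⊢
  rw [hdiff]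
  have h₁ : serre (w - 1) f z = qderiv f z - ((w : ℂ) - 1) / 12 * Eis 2 z * f z := by
    simp [serre]
  push_cast at h₂ h₄ h₆ ⊢
  linear_combination Eis 4 z * serre (w - 1) f z * h₄ + Eis 4 z ^ 2 * h₂ -
    Eis 4 z * (((w : ℂ) + 1) / 12) * f z * h₆ + Eis 4 z * (((w : ℂ) + 1) / 12) * Eis 6 z * h₁

end

/-- depth `1` lowering operator: for `w ≡ 0 (mod 6)`, `w ≥ 12`, the
operator `K^down_w f = Δ⁻¹(E_4 ∂_{w-1} f + ((w-1)/12) E_6 f)` maps the normalized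
extremal quasimodular form `f_w` of depth `1` to `(w/6) f_{w-6}`, and
`K^down_{w+6}(E_4 ∂_{w-1} f_w − ((w+1)/12) E_6 f_w) = 12(w+1)(w+5) f_w`. -/
theorem depth_one_kdown (w : ℤ) (hw6 : w % 6 = 0) (hw : 12 ≤ w)
    (fw : ℍ → ℂ) (hfw : IsNormalizedExtremalQM w 1 fw)
    (hode : ∀ z : ℍ,
      serreIter (w - 1) 2 fw z - ((w : ℂ) ^ 2 - 1) / 144 * Eis 4 z * fw z = 0)
    (fw6 : ℍ → ℂ) (hfw6 : IsNormalizedExtremalQM (w - 6) 1 fw6) :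
    (∀ z : ℍ,
      (Eis 4 z * serre (w - 1) fw z + ((w : ℂ) - 1) / 12 * Eis 6 z * fw z) / Disc z =
        (w : ℂ) / 6 * fw6 z) ∧
    (∀ z : ℍ,
      (Eis 4 z *
          serre (w + 5)
            (fun t : ℍ => Eis 4 t * serre (w - 1) fw t - ((w : ℂ) + 1) / 12 * Eis 6 t * fw t) z +
        ((w : ℂ) + 5) / 12 * Eis 6 z *
          (Eis 4 z * serre (w - 1) fw z - ((w : ℂ) + 1) / 12 * Eis 6 z * fw z)) / Disc z =
      12 * ((w : ℂ) + 1) * ((w : ℂ) + 5) * fw z) := by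
  obtain ⟨p, hp⟩ := exists_hasQSeries_of_mem_QM_one hfw.1
  exact ⟨kdown_eq_of_isNormalizedExtremalQM hw6 hw hfw hfw6, kdown_kup_eq hp hode⟩
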